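/- Let T̄ be an upper transition operator on ℒ(X). If T̄ is weakly ergodic and 𝒢(T̄) has a top class, then T̄ satisfies (TCA). -/

import Mathlib

open Filter Topology

namespace WeakErg

variable {X : Type*} [Fintype X] [Nonempty X]

/-- Indicator function of a set, as a real-valued function. -/
noncomputable def ind (A : Set X) : X → ℝ := A.indicator 1

/-- Upper transition operator axioms: dominated by the max, sub-additive,
non-negatively homogeneous. -/
def IsUTO (T : (X → ℝ) → (X → ℝ)) : Prop :=
  (∀ (h : X → ℝ) (x : X), T h x ≤ ⨆ y, h y) ∧
  (∀ (h g : X → ℝ) (x : X), T (h + g) x ≤ T h x + T g x) ∧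
  (∀ (l : ℝ), 0 ≤ l → ∀ h : X → ℝ, T (l • h) = l • T h)

/-- The topical map `T̄_f : h ↦ f + T̄ h`. -/
def Tf (T : (X → ℝ) → (X → ℝ)) (f : X → ℝ) : (X → ℝ) → (X → ℝ) :=
  fun h => f + T h

/-- Edge relation of the (upper) accessibility graph 𝒢(T): an edge from `x` to `y`
iff `[T 𝟙_y](x) > 0`. -/
def Edge (T : (X → ℝ) → (X → ℝ)) (x y : X) : Prop := 0 < T (ind {y}) x

/-- Accessibility: `x = y` or there is a directed path from `x` to `y`. -/
def Acc' (T : (X → ℝ) → (X → ℝ)) : X → X → Prop := Relation.ReflTransGen (Edge T)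

/-- `x` and `y` communicate. -/
def Comm (T : (X → ℝ) → (X → ℝ)) (x y : X) : Prop := Acc' T x y ∧ Acc' T y x

/-- `S` is a communication class: an equivalence class of the communication relation. -/
def IsCommClass (T : (X → ℝ) → (X → ℝ)) (S : Set X) : Prop :=
  ∃ x : X, S = {y | Comm T x y}

/-- A nonempty set `S` is closed in 𝒢(T): no state outside `S` is accessible from `S`. -/
def ClosedIn (T : (X → ℝ) → (X → ℝ)) (S : Set X) : Prop :=
  S.Nonempty ∧ ∀ x ∈ S, ∀ y ∉ S, ¬ Acc' T x y

/-- 𝒢(T) is strongly connected. -/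
def StronglyConnected (T : (X → ℝ) → (X → ℝ)) : Prop := ∀ x y : X, Acc' T x y

/-- A set `S` is absorbing for `T`: from each state outside `S` the `k`-step upper
probability of staying outside `S` drops below 1 for some `k`. -/
def Absorbing (T : (X → ℝ) → (X → ℝ)) (S : Set X) : Prop :=
  ∀ x ∉ S, ∃ k : ℕ, T^[k] (ind Sᶜ) x < 1

/-- `R` is a top class of 𝒢(T): a communication class accessible from every state. -/
def IsTopClass (T : (X → ℝ) → (X → ℝ)) (R : Set X) : Prop :=
  IsCommClass T R ∧ ∀ x : X, ∀ y ∈ R, Acc' T x y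

/-- (TCA): 𝒢(T) has a top class that is absorbing. -/
def TCA (T : (X → ℝ) → (X → ℝ)) : Prop :=
  ∃ R : Set X, IsTopClass T R ∧ Absorbing T R

/-- `T` is weakly ergodic: for every `f`, the upper expected time averages
`(1/k)·[T̄_f^k(0)](x)` converge to a limit independent of `x`. -/
def WeaklyErgodic (T : (X → ℝ) → (X → ℝ)) : Prop :=
  ∀ f : X → ℝ, ∃ μ : ℝ, ∀ x : X,
    Tendsto (fun k : ℕ => (1 / (k : ℝ)) * (Tf T f)^[k] 0 x) atTop (𝓝 μ)

/-- `μ` is an additive eigenvalue of `G`. -/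
def IsAddEigenvalue (G : (X → ℝ) → (X → ℝ)) (μ : ℝ) : Prop :=
  ∃ h : X → ℝ, G h = h + fun _ => μ

/-- A transition matrix on `X`: nonnegative entries with rows summing to one. -/
structure TransMat (Y : Type*) [Fintype Y] where
  P : Y → Y → ℝ
  nonneg : ∀ x y, 0 ≤ P x y
  rowSum : ∀ x, ∑ y, P x y = 1

/-- The action of a transition matrix on functions. -/
def TransMat.apply (T : TransMat X) (h : X → ℝ) : X → ℝ :=
  fun x => ∑ y, T.P x y * h y

/-- A set of transition matrices is separately specified. -/
def SepSpec (𝒯 : Set (TransMat X)) : Prop :=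
  ∀ T₁ ∈ 𝒯, ∀ T₂ ∈ 𝒯, ∀ A : Set X, ∃ T₃ ∈ 𝒯,
    (∀ x ∈ A, T₃.P x = T₁.P x) ∧ (∀ y ∉ A, T₃.P y = T₂.P y)

/-- `Tbar` is the upper envelope of the set `𝒯` of transition matrices. -/
def IsUpperEnv (𝒯 : Set (TransMat X)) (Tbar : (X → ℝ) → (X → ℝ)) : Prop :=
  ∀ (h : X → ℝ) (x : X), Tbar h x = ⨆ T : 𝒯, TransMat.apply T.1 h x

/-- The repetition-independent upper expected time average
`sup_{T ∈ 𝒯} (1/k)·[T_f^k(0)](x)`. -/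
noncomputable def riSeq (𝒯 : Set (TransMat X)) (f : X → ℝ) (x : X) (k : ℕ) : ℝ :=
  ⨆ T : 𝒯, (1 / (k : ℝ)) * (Tf (TransMat.apply T.1) f)^[k] 0 x

/-- Weak ergodicity of the imprecise Markov chain under repetition independence. -/
def RIWeaklyErgodic (𝒯 : Set (TransMat X)) : Prop :=
  ∀ f : X → ℝ, ∃ μ : ℝ, ∀ x : X, Tendsto (riSeq 𝒯 f x) atTop (𝓝 μ)

end WeakErg

namespace WeakErg

theorem uto_mono {X : Type*} [Fintype X] [Nonempty X]
    {T : (X → ℝ) → (X → ℝ)} (hT : IsUTO T) {h g : X → ℝ} (hg : h ≤ g) : T h ≤ T g := by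
  intro x
  have h1 := hT.2.1 g (h - g) x
  have h2 := hT.1 (h - g) x
  have h3 : (⨆ y, (h - g) y) ≤ 0 := ciSup_le fun y => by
    have := hg y
    simp only [Pi.sub_apply]
    linarith
  rw [add_sub_cancel] at h1
  linarith

theorem uto_zero {X : Type*} [Fintype X] [Nonempty X]
    {T : (X → ℝ) → (X → ℝ)} (hT : IsUTO T) : T 0 = 0 := by
  have := hT.2.2 0 le_rfl 0
  simpa using this

theorem uto_sum {X : Type*} [Fintype X] [Nonempty X]
    {T : (X → ℝ) → (X → ℝ)} (hT : IsUTO T) (s : Finset X) (F : X → X → ℝ) (x : X) :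
    T (∑ z ∈ s, F z) x ≤ ∑ z ∈ s, T (F z) x := by
  classical
  induction s using Finset.induction_on with
  | empty => simp [uto_zero hT]
  | insert a s ha ih =>
    rw [Finset.sum_insert ha, Finset.sum_insert ha]
    have := hT.2.1 (F a) (∑ z ∈ s, F z) x
    linarith

theorem uto_ind_le {X : Type*} [Fintype X] [Nonempty X]
    {T : (X → ℝ) → (X → ℝ)} (hT : IsUTO T) {R : Set X}
    (hR : ∀ y ∈ R, ∀ z ∉ R, ¬ Edge T y z) : T (ind Rᶜ) ≤ ind Rᶜ := by
  classical
  intro y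
  by_cases hy : y ∈ R
  · have h1 : ind Rᶜ = ∑ z ∈ Finset.univ.filter (fun z => z ∉ R), ind ({z} : Set X) := by
      funext w
      simp [ind, Set.indicator_apply, Finset.sum_apply]
    have h2 := uto_sum hT (Finset.univ.filter (fun z => z ∉ R)) (fun z => ind ({z} : Set X)) y
    rw [← h1] at h2
    have h3 : ∑ z ∈ Finset.univ.filter (fun z => z ∉ R), T (ind ({z} : Set X)) y ≤ 0 :=
      Finset.sum_nonpos fun z hz => not_lt.1 (hR y hy z (Finset.mem_filter.1 hz).2)
    have h4 : ind Rᶜ y = 0 := by simp [ind, hy]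
    linarith
  · have h4 : ind Rᶜ y = 1 := by simp [ind, hy]
    rw [h4]
    refine (hT.1 _ y).trans (ciSup_le fun z => ?_)
    by_cases hz : z ∈ R <;> simp [ind, hz]

/-- if `T̄` is weakly ergodic and 𝒢(T̄) has a top class,
then `T̄` satisfies (TCA). -/
theorem TCA_of_weaklyErgodic_topClass {X : Type*} [Fintype X] [Nonempty X]
    (T : (X → ℝ) → (X → ℝ)) (hT : IsUTO T) (hwe : WeaklyErgodic T)
    (htop : ∃ R : Set X, IsTopClass T R) :
    TCA T := by
  obtain ⟨R, hR⟩ := htop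
  refine ⟨R, hR, ?_⟩
  intro x hx
  by_contra! hcon
  obtain ⟨⟨r, hr⟩, hacc⟩ := hR
  have hrR : r ∈ R := by
    rw [hr]
    exact ⟨Relation.ReflTransGen.refl, Relation.ReflTransGen.refl⟩
  have hclosed : ∀ y ∈ R, ∀ z ∉ R, ¬ Edge T y z := by
    intro y hy z hz he
    apply hz
    rw [hr] at hy ⊢
    exact ⟨hy.1.tail he, hacc z r hrR⟩
  have hle := uto_ind_le hT hclosed
  set f := ind Rᶜ with hf
  have hpow : ∀ k : ℕ, T^[k] f ≤ f := by
    intro k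
    induction k with
    | zero => exact le_rfl
    | succ k ih =>
      rw [Function.iterate_succ_apply']
      exact (uto_mono hT ih).trans hle
  have hup : ∀ k : ℕ, (Tf T f)^[k] 0 ≤ (k : ℝ) • f := by
    intro k
    induction k with
    | zero => simp
    | succ k ih =>
      rw [Function.iterate_succ_apply']
      intro y
      have h1 := uto_mono hT ih y
      rw [hT.2.2 _ (Nat.cast_nonneg k)] at h1
      have h2 := mul_le_mul_of_nonneg_left (hle y) (Nat.cast_nonneg (α := ℝ) k)
      simp only [Tf, Pi.add_apply, Pi.smul_apply, smul_eq_mul] at h1 ⊢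
      push_cast
      linarith
  have hlow : ∀ k : ℕ, ((k : ℝ) + 1) • T^[k] f ≤ (Tf T f)^[k + 1] 0 := by
    intro k
    induction k with
    | zero =>
      intro y
      simp [Tf, uto_zero hT]
    | succ k ih =>
      rw [Function.iterate_succ_apply' (Tf T f)]
      intro y
      have h1 := uto_mono hT ih y
      rw [hT.2.2 _ (by positivity), ← Function.iterate_succ_apply' T] at h1
      have h2 := hpow (k + 1) y
      simp only [Tf, Pi.add_apply, Pi.smul_apply, smul_eq_mul] at h1 ⊢
      push_cast
      linarith
  obtain ⟨μ, hμ⟩ := hwe f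
  have hμ0 : μ ≤ 0 := by
    refine le_of_tendsto (hμ r) (Eventually.of_forall fun k => ?_)
    have h1 := hup k r
    have h2 : f r = 0 := by simp [hf, ind, hrR]
    simp only [Pi.smul_apply, h2, smul_zero] at h1
    exact mul_nonpos_of_nonneg_of_nonpos (by positivity) h1
  have hμ1 : 1 ≤ μ := by
    refine ge_of_tendsto (hμ x) ?_
    filter_upwards [eventually_ge_atTop 1] with k hk
    obtain ⟨m, rfl⟩ : ∃ m, k = m + 1 := ⟨k - 1, by omega⟩
    have h1 := hlow m x
    have h2 := hcon m
    have hm : (0 : ℝ) < (m : ℝ) + 1 := by positivity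
    simp only [Pi.smul_apply, smul_eq_mul] at h1
    push_cast
    rw [one_div, ← div_eq_inv_mul, le_div_iff₀ hm]
    nlinarith
  linarith

end WeakErg
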